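/- arXiv:2406.18793 — 5 statements merged into one kernel-verified Lean document; each statement's English description precedes it below -/
import Mathlib

section
/- Let γ, χ be real constants with χ ≠ 0, and set d₁ = γ²/(3χ), d₂ = γ/(3χ), d₃ = −2γ³/(27χ²). Let w : ℝ × ℝ → ℂ be C³ in its first variable and C¹ in its second, and define v(ξ,τ) := exp(i·(d₂·ξ + d₃·τ))·w(ξ − d₁·τ, τ). Then v satisfies i·v_τ + γ·v_ξξ + i·χ·v_ξξξ = |v|²·v at a point (ξ,τ) if and only if w satisfies w_s + χ·w_yyy + i·|w|²·w = 0 at the corresponding point (y,s) = (ξ − d₁·τ, τ). -/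
open Complex in
/-- Differentiation of a plane wave with real phase `p x` times a translated profile. -/
theorem hasDerivAt_exp_I_mul_mul {p : ℝ → ℝ} {u : ℝ → ℂ} {p' x : ℝ} {u' : ℂ}
    (hp : HasDerivAt p p' x) (hu : HasDerivAt u u' x) :
    HasDerivAt (fun t => exp (I * (p t : ℂ)) * u t)
      (exp (I * (p x : ℂ)) * (I * p' * u x + u')) x := by
  convert! ((hp.ofReal_comp.const_mul I).cexp).mul hu using 1
  ring

open Topology Filter in
/-- Chain rule for `r ↦ f (c r) r`, where only the second partial derivative `B` of `f` is assumed
to be jointly continuous at the point. -/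
theorem hasDerivAt_along_graph {E : Type*} [NormedAddCommGroup E] [NormedSpace ℝ E]
    {f B : ℝ → ℝ → E} {c : ℝ → ℝ} {c' t : ℝ} {A : E}
    (hc : HasDerivAt c c' t) (hA : HasDerivAt (fun y => f y t) A (c t))
    (hB : ∀ y s, HasDerivAt (fun r => f y r) (B y s) s)
    (hcont : ContinuousAt (fun q : ℝ × ℝ => B q.1 q.2) (c t, t)) :
    HasDerivAt (fun r => f (c r) r) (c' • A + B (c t) t) t := by
  have hfst : HasDerivAt (fun r => f (c r) t) (c' • A) t := hA.scomp t hc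
  have hsnd : HasDerivAt (fun r => f (c r) r - f (c r) t) (B (c t) t) t := by
    rw [hasDerivAt_iff_isLittleO, Asymptotics.isLittleO_iff]
    intro ε hε
    obtain ⟨δ, hδ, hball⟩ := Metric.continuousAt_iff.1 hcont ε hε
    filter_upwards [hc.continuousAt (Metric.ball_mem_nhds _ hδ), Metric.ball_mem_nhds t hδ]
      with r hcr hr
    have hderiv : ∀ s ∈ Metric.ball t δ,
        HasDerivWithinAt (fun s => f (c r) s - s • B (c t) t) (B (c r) s - B (c t) t)
          (Metric.ball t δ) s := fun s _ => by
      simpa using! ((hB (c r) s).sub ((hasDerivAt_id s).smul_const (B (c t) t))).hasDerivWithinAt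
    have hbound : ∀ s ∈ Metric.ball t δ, ‖B (c r) s - B (c t) t‖ ≤ ε := fun s hs => by
      rw [← dist_eq_norm]
      exact (hball (x := (c r, s)) (max_lt hcr hs)).le
    have hmvt := (convex_ball t δ).norm_image_sub_le_of_norm_hasDerivWithin_le hderiv hbound
      (Metric.mem_ball_self hδ) hr
    convert hmvt using 2
    rw [sub_smul]
    abel
  convert! hfst.add hsnd using 1
  ext r
  simp


/-- the Gauge transformation.  Let χ ≠ 0, d₁ = γ²/(3χ), d₂ = γ/(3χ),
d₃ = −2γ³/(27χ²), let w be C³ in its first variable and C¹ in its second (with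
derivatives wy, wyy, wyyy, ws), and set v(ξ,τ) = exp(i(d₂ξ + d₃τ))·w(ξ − d₁τ, τ).
Then, for the derivative functions vξ, vξξ, vξξξ, vτ of v, the equation
i·v_τ + γ·v_ξξ + i·χ·v_ξξξ = |v|²·v holds at (ξ,τ) if and only if
w_s + χ·w_yyy + i·|w|²·w = 0 holds at (y,s) = (ξ − d₁τ, τ). -/
theorem stmt1 (γ χ : ℝ) (hχ : χ ≠ 0)
    (d₁ d₂ d₃ : ℝ)
    (hd₁ : d₁ = γ ^ 2 / (3 * χ)) (hd₂ : d₂ = γ / (3 * χ))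
    (hd₃ : d₃ = -2 * γ ^ 3 / (27 * χ ^ 2))
    (w wy wyy wyyy ws : ℝ → ℝ → ℂ)
    -- w is C³ in the first variable (derivatives wy, wyy, wyyy, all continuous) :
    (hwy : ∀ y s : ℝ, HasDerivAt (fun z => w z s) (wy y s) y)
    (hwyy : ∀ y s : ℝ, HasDerivAt (fun z => wy z s) (wyy y s) y)
    (hwyyy : ∀ y s : ℝ, HasDerivAt (fun z => wyy z s) (wyyy y s) y)
    (hwyc : Continuous fun q : ℝ × ℝ => wyyy q.1 q.2)
    -- w is C¹ in the second variable (derivative ws, continuous) :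
    (hws : ∀ y s : ℝ, HasDerivAt (fun r => w y r) (ws y s) s)
    (hwsc : Continuous fun q : ℝ × ℝ => ws q.1 q.2)
    (v vξ vξξ vξξξ vτ : ℝ → ℝ → ℂ)
    (hv : ∀ ξ τ : ℝ,
        v ξ τ = Complex.exp (Complex.I * ((d₂ * ξ + d₃ * τ : ℝ) : ℂ))
          * w (ξ - d₁ * τ) τ)
    -- vξ, vξξ, vξξξ, vτ are the derivatives of v :
    (hvξ : ∀ ξ τ : ℝ, HasDerivAt (fun y => v y τ) (vξ ξ τ) ξ)
    (hvξξ : ∀ ξ τ : ℝ, HasDerivAt (fun y => vξ y τ) (vξξ ξ τ) ξ)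
    (hvξξξ : ∀ ξ τ : ℝ, HasDerivAt (fun y => vξξ y τ) (vξξξ ξ τ) ξ)
    (hvτ : ∀ ξ τ : ℝ, HasDerivAt (fun s => v ξ s) (vτ ξ τ) τ) :
    ∀ ξ τ : ℝ,
      (Complex.I * vτ ξ τ + (γ : ℂ) * vξξ ξ τ + Complex.I * (χ : ℂ) * vξξξ ξ τ
          = (‖v ξ τ‖ : ℂ) ^ 2 * v ξ τ)
        ↔ (ws (ξ - d₁ * τ) τ + (χ : ℂ) * wyyy (ξ - d₁ * τ) τ
            + Complex.I * (‖w (ξ - d₁ * τ) τ‖ : ℂ) ^ 2 * w (ξ - d₁ * τ) τ = 0) := by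
  have hphase : ∀ ξ τ : ℝ, HasDerivAt (fun x => d₂ * x + d₃ * τ) d₂ ξ := fun ξ τ => by
    simpa using ((hasDerivAt_id ξ).const_mul d₂).add_const (d₃ * τ)
  have hξ : ∀ ξ τ : ℝ, vξ ξ τ = Complex.exp (Complex.I * ((d₂ * ξ + d₃ * τ : ℝ) : ℂ))
      * (Complex.I * d₂ * w (ξ - d₁ * τ) τ + wy (ξ - d₁ * τ) τ) := fun ξ τ => by
    refine (hvξ ξ τ).unique ?_
    simp only [hv]
    exact hasDerivAt_exp_I_mul_mul (hphase ξ τ) ((hwy _ τ).comp_sub_const ξ (d₁ * τ))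
  have hξξ : ∀ ξ τ : ℝ, vξξ ξ τ = Complex.exp (Complex.I * ((d₂ * ξ + d₃ * τ : ℝ) : ℂ))
      * (Complex.I * d₂ * (Complex.I * d₂ * w (ξ - d₁ * τ) τ + wy (ξ - d₁ * τ) τ)
        + (Complex.I * d₂ * wy (ξ - d₁ * τ) τ + wyy (ξ - d₁ * τ) τ)) := fun ξ τ => by
    refine (hvξξ ξ τ).unique ?_
    simp only [hξ]
    exact hasDerivAt_exp_I_mul_mul (hphase ξ τ)
      ((((hwy _ τ).comp_sub_const ξ (d₁ * τ)).const_mul _).add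
        ((hwyy _ τ).comp_sub_const ξ (d₁ * τ)))
  intro ξ τ
  have hξξξ : vξξξ ξ τ = Complex.exp (Complex.I * ((d₂ * ξ + d₃ * τ : ℝ) : ℂ))
      * (Complex.I * d₂ * (Complex.I * d₂ * (Complex.I * d₂ * w (ξ - d₁ * τ) τ
          + wy (ξ - d₁ * τ) τ) + (Complex.I * d₂ * wy (ξ - d₁ * τ) τ + wyy (ξ - d₁ * τ) τ))
        + (Complex.I * d₂ * (Complex.I * d₂ * wy (ξ - d₁ * τ) τ + wyy (ξ - d₁ * τ) τ)
          + (Complex.I * d₂ * wyy (ξ - d₁ * τ) τ + wyyy (ξ - d₁ * τ) τ))) := by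
    refine (hvξξξ ξ τ).unique ?_
    simp only [hξξ]
    have h0 := (hwy _ τ).comp_sub_const ξ (d₁ * τ)
    have h1 := (hwyy _ τ).comp_sub_const ξ (d₁ * τ)
    have h2 := (hwyyy _ τ).comp_sub_const ξ (d₁ * τ)
    exact hasDerivAt_exp_I_mul_mul (hphase ξ τ)
      (((h0.const_mul _).add h1).const_mul _ |>.add ((h1.const_mul _).add h2))
  have hτ : vτ ξ τ = Complex.exp (Complex.I * ((d₂ * ξ + d₃ * τ : ℝ) : ℂ))
      * (Complex.I * d₃ * w (ξ - d₁ * τ) τ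
        + ((-d₁) • wy (ξ - d₁ * τ) τ + ws (ξ - d₁ * τ) τ)) := by
    refine (hvτ ξ τ).unique ?_
    simp only [hv]
    have hp : HasDerivAt (fun t => d₂ * ξ + d₃ * t) d₃ τ := by
      simpa using ((hasDerivAt_id τ).const_mul d₃).const_add (d₂ * ξ)
    have hc : HasDerivAt (fun t => ξ - d₁ * t) (-d₁) τ := by
      simpa using ((hasDerivAt_id τ).const_mul d₁).const_sub ξ
    exact hasDerivAt_exp_I_mul_mul hp
      (hasDerivAt_along_graph hc (hwy _ τ) hws hwsc.continuousAt)
  have hnorm : ‖v ξ τ‖ = ‖w (ξ - d₁ * τ) τ‖ := by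
    rw [hv, norm_mul, Complex.norm_exp_I_mul_ofReal, one_mul]
  have hχ' : (χ : ℂ) ≠ 0 := Complex.ofReal_ne_zero.2 hχ
  have hyy : (γ : ℂ) - 3 * χ * d₂ = 0 := by
    rw [hd₂]; push_cast; field_simp; ring
  have hy : -(d₁ : ℂ) + 2 * γ * d₂ - 3 * χ * d₂ ^ 2 = 0 := by
    rw [hd₁, hd₂]; push_cast; field_simp; ring
  have h0 : -(d₃ : ℂ) - γ * d₂ ^ 2 + χ * d₂ ^ 3 = 0 := by
    rw [hd₂, hd₃]; push_cast; field_simp; ring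
  rw [hnorm, hξξ, hξξξ, hτ, hv, Complex.real_smul, ← sub_eq_zero]
  generalize hE : Complex.exp (Complex.I * ((d₂ * ξ + d₃ * τ : ℝ) : ℂ)) = e
  have he : Complex.I * e ≠ 0 := mul_ne_zero Complex.I_ne_zero (hE ▸ Complex.exp_ne_zero _)
  refine Iff.trans ?_ (mul_eq_zero_iff_left he)
  generalize w (ξ - d₁ * τ) τ = W, wy (ξ - d₁ * τ) τ = W₁, wyy (ξ - d₁ * τ) τ = W₂,
    wyyy (ξ - d₁ * τ) τ = W₃, ws (ξ - d₁ * τ) τ = S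
  generalize (‖W‖ : ℂ) = N
  push_cast
  refine Eq.congr_left ?_
  have hI3 : Complex.I ^ 3 = -Complex.I := by rw [pow_succ, Complex.I_sq, neg_one_mul]
  have hI4 : Complex.I ^ 4 = 1 := Complex.I_pow_four
  linear_combination (exp := 1) e * (W * h0 + Complex.I * W₁ * hy + W₂ * hyy)
    + e * (d₃ * W + γ * d₂ ^ 2 * W + 3 * χ * d₂ * W₂ - N ^ 2 * W) * Complex.I_sq
    + 3 * e * χ * d₂ ^ 2 * W₁ * hI3 + e * χ * d₂ ^ 3 * W * hI4
end

section
/- Let ε ≥ 0 with 3χ − 4ε > 0 and let u be a classical solution of the ε-regularized problem. Then for every t ∈ (0,T): (d/dt)⟨e^x, |u(·,t)|²⟩ − (χ − ε)·𝔅(t)·⟨e^x, |u(·,t)|²⟩ + (3χ − 4ε)·𝔅(t)·⟨e^x, |u_x(·,t)|²⟩ + 2ε·𝔅(t)·⟨e^x, |u_xx(·,t)|²⟩ = 2γ·ℭ(t)·Im ∫₀¹ e^x·conj(u(x,t))·u_x(x,t) dx − 2·Im ∫₀¹ I(x,t)·e^x·conj(u(x,t))·u_x(x,t) dx, where ⟨e^x,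 f⟩ = ∫₀¹ e^x·f(x) dx. -/
theorem intervalIntegral_im_eq {f : ℝ → ℂ} {a b : ℝ}
    (hf : IntervalIntegrable f MeasureTheory.volume a b) :
    (∫ x in a..b, f x).im = ∫ x in a..b, (f x).im :=
  (Complex.imCLM.intervalIntegral_comp_comm hf).symm

/-- Differentiation of an integral whose integrand has a jointly continuous derivative
on a closed rectangle. -/
theorem hasDerivAt_integral_of_continuousOn_rect {T t : ℝ} (ht : t ∈ Set.Ioo (0 : ℝ) T)
    {f f' : ℝ → ℝ → ℝ}
    (hf : ContinuousOn (fun q : ℝ × ℝ => f q.1 q.2) (Set.Icc 0 1 ×ˢ Set.Icc 0 T))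
    (hf' : ContinuousOn (fun q : ℝ × ℝ => f' q.1 q.2) (Set.Icc 0 1 ×ˢ Set.Icc 0 T))
    (hd : ∀ x ∈ Set.Icc (0 : ℝ) 1, ∀ s ∈ Set.Ioo (0 : ℝ) T,
      HasDerivAt (fun s => f x s) (f' x s) s) :
    HasDerivAt (fun s => ∫ x in (0 : ℝ)..1, f x s) (∫ x in (0 : ℝ)..1, f' x t) t := by
  obtain ⟨C, hC⟩ := (isCompact_Icc.prod isCompact_Icc).exists_bound_of_continuousOn hf'
  have slice : ∀ {g : ℝ → ℝ → ℝ},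
      ContinuousOn (fun q : ℝ × ℝ => g q.1 q.2) (Set.Icc 0 1 ×ˢ Set.Icc 0 T) →
      ∀ s ∈ Set.Ioo (0 : ℝ) T,
        IntervalIntegrable (fun x => g x s) MeasureTheory.volume 0 1 := by
    intro g hg s hs
    apply ContinuousOn.intervalIntegrable_of_Icc zero_le_one
    exact hg.comp (f := fun x : ℝ => (x, s)) (by fun_prop)
      (fun x hx => ⟨hx, Set.Ioo_subset_Icc_self hs⟩)
  have hsub : ∀ x ∈ Set.uIoc (0 : ℝ) 1, x ∈ Set.Icc (0 : ℝ) 1 := by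
    intro x hx
    rw [Set.uIoc_of_le zero_le_one] at hx
    exact Set.Ioc_subset_Icc_self hx
  have hnhds : Set.Ioo (0 : ℝ) T ∈ nhds t := Ioo_mem_nhds ht.1 ht.2
  refine (intervalIntegral.hasDerivAt_integral_of_dominated_loc_of_deriv_le
    (F := fun s x => f x s) (F' := fun s x => f' x s) (bound := fun _ => C) hnhds
    ?_ (slice hf t ht) ?_ ?_ ?_ ?_).2
  · filter_upwards [hnhds] with s hs
    exact (intervalIntegrable_iff.1 (slice hf s hs)).aestronglyMeasurable
  · exact (intervalIntegrable_iff.1 (slice hf' t ht)).aestronglyMeasurable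
  · exact Filter.Eventually.of_forall fun x hx s hs =>
      hC (x, s) ⟨hsub x hx, Set.Ioo_subset_Icc_self hs⟩
  · exact intervalIntegrable_const
  · exact Filter.Eventually.of_forall fun x hx s hs => hd x (hsub x hx) s hs

/-- The weighted energy identity at a fixed time, obtained by integrating the derivative of
the energy flux. -/
theorem integral_exp_mul_energy_density (γ' χ' ε' : ℝ) (r : ℝ → ℝ)
    (v v₁ v₂ v₃ v₄ w : ℝ → ℂ) (hr : ContinuousOn r (Set.Icc 0 1))
    (h₁ : ∀ x ∈ Set.Icc (0 : ℝ) 1, HasDerivWithinAt v (v₁ x) (Set.Icc 0 1) x)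
    (h₂ : ∀ x ∈ Set.Icc (0 : ℝ) 1, HasDerivWithinAt v₁ (v₂ x) (Set.Icc 0 1) x)
    (h₃ : ∀ x ∈ Set.Icc (0 : ℝ) 1, HasDerivWithinAt v₂ (v₃ x) (Set.Icc 0 1) x)
    (h₄ : ∀ x ∈ Set.Icc (0 : ℝ) 1, HasDerivWithinAt v₃ (v₄ x) (Set.Icc 0 1) x)
    (hw : ContinuousOn w (Set.Icc 0 1))
    (hpde : ∀ x ∈ Set.Ioo (0 : ℝ) 1,
      Complex.I * w x + Complex.I * χ' * v₃ x + γ' * v₂ x + Complex.I * (r x : ℂ) * v₁ x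
        + Complex.I * ε' * v₄ x - (‖v x‖ : ℂ) ^ 2 * v x = 0)
    (hv0 : v 0 = 0) (hv1 : v 1 = 0) (hv₁0 : v₁ 0 = 0) (hv₁1 : v₁ 1 = 0) :
    ∫ x in (0 : ℝ)..1, Real.exp x * (2 * ((v x).re * (w x).re + (v x).im * (w x).im)) =
      (χ' - ε') * (∫ x in (0 : ℝ)..1, Real.exp x * ‖v x‖ ^ 2)
        - (3 * χ' - 4 * ε') * (∫ x in (0 : ℝ)..1, Real.exp x * ‖v₁ x‖ ^ 2)
        - 2 * ε' * (∫ x in (0 : ℝ)..1, Real.exp x * ‖v₂ x‖ ^ 2)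
        + 2 * γ' * (∫ x in (0 : ℝ)..1,
            (Real.exp x : ℂ) * (starRingEnd ℂ (v x) * v₁ x)).im
        - 2 * (∫ x in (0 : ℝ)..1,
            Complex.I * (r x : ℂ) * (Real.exp x : ℂ) * (starRingEnd ℂ (v x) * v₁ x)).im := by
  have cv : ContinuousOn v (Set.Icc 0 1) := fun x hx => (h₁ x hx).continuousWithinAt
  have cv₁ : ContinuousOn v₁ (Set.Icc 0 1) := fun x hx => (h₂ x hx).continuousWithinAt
  have cv₂ : ContinuousOn v₂ (Set.Icc 0 1) := fun x hx => (h₃ x hx).continuousWithinAt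
  have cv₃ : ContinuousOn v₃ (Set.Icc 0 1) := fun x hx => (h₄ x hx).continuousWithinAt
  have cre : ∀ {g : ℝ → ℂ}, ContinuousOn g (Set.Icc 0 1) →
      ContinuousOn (fun x => (g x).re) (Set.Icc 0 1) :=
    fun hg => Complex.continuous_re.comp_continuousOn hg
  have cim : ∀ {g : ℝ → ℂ}, ContinuousOn g (Set.Icc 0 1) →
      ContinuousOn (fun x => (g x).im) (Set.Icc 0 1) :=
    fun hg => Complex.continuous_im.comp_continuousOn hg
  have cstar : ContinuousOn (fun x => starRingEnd ℂ (v x)) (Set.Icc 0 1) :=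
    Complex.continuous_conj.comp_continuousOn cv
  have cexp : ContinuousOn (fun x : ℝ => (Real.exp x : ℂ)) (Set.Icc 0 1) := by fun_prop
  have crC : ContinuousOn (fun x : ℝ => (r x : ℂ)) (Set.Icc 0 1) :=
    Complex.continuous_ofReal.comp_continuousOn hr
  have hre := cre cv
  have hre₁ := cre cv₁
  have hre₂ := cre cv₂
  have hre₃ := cre cv₃
  have hrew := cre hw
  have him := cim cv
  have him₁ := cim cv₁
  have him₂ := cim cv₂
  have him₃ := cim cv₃
  have himw := cim hw
  rw [intervalIntegral_im_eq (ContinuousOn.intervalIntegrable_of_Icc zero_le_one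
      (by fun_prop)),
    intervalIntegral_im_eq (ContinuousOn.intervalIntegrable_of_Icc zero_le_one
      (by fun_prop))]
  have iw : IntervalIntegrable (fun x => Real.exp x *
      (2 * ((v x).re * (w x).re + (v x).im * (w x).im))) MeasureTheory.volume 0 1 :=
    ContinuousOn.intervalIntegrable_of_Icc zero_le_one (by fun_prop)
  have i₀ : IntervalIntegrable (fun x => (χ' - ε') * (Real.exp x * ‖v x‖ ^ 2))
      MeasureTheory.volume 0 1 :=
    ContinuousOn.intervalIntegrable_of_Icc zero_le_one (by fun_prop)
  have i₁ : IntervalIntegrable (fun x => (3 * χ' - 4 * ε') * (Real.exp x * ‖v₁ x‖ ^ 2))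
      MeasureTheory.volume 0 1 :=
    ContinuousOn.intervalIntegrable_of_Icc zero_le_one (by fun_prop)
  have i₂ : IntervalIntegrable (fun x => (2 * ε') * (Real.exp x * ‖v₂ x‖ ^ 2))
      MeasureTheory.volume 0 1 :=
    ContinuousOn.intervalIntegrable_of_Icc zero_le_one (by fun_prop)
  have i₃ : IntervalIntegrable (fun x => (2 * γ') *
      ((Real.exp x : ℂ) * (starRingEnd ℂ (v x) * v₁ x)).im) MeasureTheory.volume 0 1 :=
    ContinuousOn.intervalIntegrable_of_Icc zero_le_one
      (continuousOn_const.mul (cim (by fun_prop)))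
  have i₄ : IntervalIntegrable (fun x => 2 *
      (Complex.I * (r x : ℂ) * (Real.exp x : ℂ) * (starRingEnd ℂ (v x) * v₁ x)).im)
      MeasureTheory.volume 0 1 :=
    ContinuousOn.intervalIntegrable_of_Icc zero_le_one
      (continuousOn_const.mul (cim (by fun_prop)))
  simp only [← intervalIntegral.integral_const_mul]
  rw [← intervalIntegral.integral_sub i₀ i₁, ← intervalIntegral.integral_sub (i₀.sub i₁) i₂,
    ← intervalIntegral.integral_add ((i₀.sub i₁).sub i₂) i₃,
    ← intervalIntegral.integral_sub (((i₀.sub i₁).sub i₂).add i₃) i₄, ← sub_eq_zero,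
    ← intervalIntegral.integral_sub iw ((((i₀.sub i₁).sub i₂).add i₃).sub i₄)]
  let flux : ℝ → ℝ := fun x => Real.exp x *
    (-χ' * (2 * ((v x).re * (v₂ x).re + (v x).im * (v₂ x).im)
        - ((v₁ x).re * (v₁ x).re + (v₁ x).im * (v₁ x).im)
        - 2 * ((v x).re * (v₁ x).re + (v x).im * (v₁ x).im)
        + ((v x).re * (v x).re + (v x).im * (v x).im))
      - 2 * γ' * ((v x).re * (v₁ x).im - (v x).im * (v₁ x).re)
      - ε' * (2 * ((v x).re * (v₃ x).re + (v x).im * (v₃ x).im)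
        - 2 * ((v₁ x).re * (v₂ x).re + (v₁ x).im * (v₂ x).im)
        - (2 * ((v x).re * (v₂ x).re + (v x).im * (v₂ x).im)
          - ((v₁ x).re * (v₁ x).re + (v₁ x).im * (v₁ x).im)
          - 2 * ((v x).re * (v₁ x).re + (v x).im * (v₁ x).im)
          + ((v x).re * (v x).re + (v x).im * (v x).im))
        + ((v₁ x).re * (v₁ x).re + (v₁ x).im * (v₁ x).im)))
  rw [intervalIntegral.integral_eq_sub_of_hasDerivAt_of_le (f := flux) zero_le_one
    (by fun_prop) ?_ (iw.sub ((((i₀.sub i₁).sub i₂).add i₃).sub i₄))]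
  · simp [flux, hv0, hv1, hv₁0, hv₁1]
  intro x hx
  have hx' := Set.Ioo_subset_Icc_self hx
  have hn : Set.Icc (0 : ℝ) 1 ∈ nhds x := Icc_mem_nhds hx.1 hx.2
  have dre : ∀ {g : ℝ → ℂ} {g' : ℂ}, HasDerivWithinAt g g' (Set.Icc 0 1) x →
      HasDerivAt (fun y => (g y).re) g'.re x := fun h =>
    Complex.reCLM.hasFDerivAt.comp_hasDerivAt x (h.hasDerivAt hn)
  have dim : ∀ {g : ℝ → ℂ} {g' : ℂ}, HasDerivWithinAt g g' (Set.Icc 0 1) x →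
      HasDerivAt (fun y => (g y).im) g'.im x := fun h =>
    Complex.imCLM.hasFDerivAt.comp_hasDerivAt x (h.hasDerivAt hn)
  have a₀ := dre (h₁ x hx')
  have a₁ := dre (h₂ x hx')
  have a₂ := dre (h₃ x hx')
  have a₃ := dre (h₄ x hx')
  have b₀ := dim (h₁ x hx')
  have b₁ := dim (h₂ x hx')
  have b₂ := dim (h₃ x hx')
  have b₃ := dim (h₄ x hx')
  have q₀₀ := (a₀.mul a₀).add (b₀.mul b₀)
  have q₀₁ := ((a₀.mul a₁).add (b₀.mul b₁)).const_mul 2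
  have q₀₂ := ((a₀.mul a₂).add (b₀.mul b₂)).const_mul 2
  have q₀₃ := ((a₀.mul a₃).add (b₀.mul b₃)).const_mul 2
  have q₁₁ := (a₁.mul a₁).add (b₁.mul b₁)
  have q₁₂ := ((a₁.mul a₂).add (b₁.mul b₂)).const_mul 2
  have k := (a₀.mul b₁).sub (b₀.mul a₁)
  have g := ((q₀₂.sub q₁₁).sub q₀₁).add q₀₀
  have hflux := (Real.hasDerivAt_exp x).mul
    (((g.const_mul (-χ')).sub (k.const_mul (2 * γ'))).sub
      ((((q₀₃.sub q₁₂).sub g).add q₁₁).const_mul ε'))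
  refine hflux.congr_deriv ?_
  have hre_eq := congrArg Complex.re (hpde x hx)
  have him_eq := congrArg Complex.im (hpde x hx)
  simp [pow_two] at hre_eq him_eq
  simp only [← Complex.normSq_eq_norm_sq, Complex.normSq_apply]
  simp [-Complex.ofReal_exp]
  linear_combination (Real.exp x) * (2 * (v x).im * hre_eq - 2 * (v x).re * him_eq)


/- Coefficients of the transformed equation on the cylinder (0,1) × (0,T):
   p(t) = 1/(β(t) − α(t)), 𝔅(t) = p(t)³, ℭ(t) = p(t)²,
   I(x,t) = i·(−α′(t)·p(t) + x·(d/dt) log p(t)). -/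
noncomputable def pcoef (α β : ℝ → ℝ) (t : ℝ) : ℝ := (β t - α t)⁻¹
noncomputable def Bcoef (α β : ℝ → ℝ) (t : ℝ) : ℝ := (pcoef α β t) ^ 3
noncomputable def Ccoef (α β : ℝ → ℝ) (t : ℝ) : ℝ := (pcoef α β t) ^ 2
noncomputable def Icoef (α β : ℝ → ℝ) (x t : ℝ) : ℂ :=
  Complex.I * ((-(deriv α t) * pcoef α β t
      + x * deriv (fun s => Real.log (pcoef α β s)) t : ℝ) : ℂ)

/- Moving boundary context: T > 0, α, β are C² and
   0 < α₀ ≤ β(t) − α(t) ≤ β₀ < ∞ on [0,T]. -/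
def MovingBoundary (T α₀ β₀ : ℝ) (α β : ℝ → ℝ) : Prop :=
  0 < T ∧ 0 < α₀ ∧ ContDiff ℝ 2 α ∧ ContDiff ℝ 2 β ∧
    ∀ t ∈ Set.Icc (0:ℝ) T, α₀ ≤ β t - α t ∧ β t - α t ≤ β₀

/- A classical solution of the ε-regularized problem: u is C⁴ in x and C¹ in t on
   [0,1] × [0,T] (with spatial derivatives ux, uxx, uxxx, uxxxx and time derivative ut,
   all continuous on [0,1] × [0,T]), satisfies
   i·u_t + i·χ·𝔅(t)·u_xxx + γ·ℭ(t)·u_xx + I(x,t)·u_x + i·ε·𝔅(t)·u_xxxx − |u|²·u = 0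
   on (0,1) × (0,T), and u = u_x = u_xx = u_xxx = 0 at x = 0 and x = 1 for all t ∈ [0,T]. -/
def IsRegSol (T γ χ ε : ℝ) (α β : ℝ → ℝ)
    (u ux uxx uxxx uxxxx ut : ℝ → ℝ → ℂ) : Prop :=
  (∀ t ∈ Set.Icc (0:ℝ) T, ∀ x ∈ Set.Icc (0:ℝ) 1,
      HasDerivWithinAt (fun y => u y t) (ux x t) (Set.Icc 0 1) x) ∧
  (∀ t ∈ Set.Icc (0:ℝ) T, ∀ x ∈ Set.Icc (0:ℝ) 1,
      HasDerivWithinAt (fun y => ux y t) (uxx x t) (Set.Icc 0 1) x) ∧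
  (∀ t ∈ Set.Icc (0:ℝ) T, ∀ x ∈ Set.Icc (0:ℝ) 1,
      HasDerivWithinAt (fun y => uxx y t) (uxxx x t) (Set.Icc 0 1) x) ∧
  (∀ t ∈ Set.Icc (0:ℝ) T, ∀ x ∈ Set.Icc (0:ℝ) 1,
      HasDerivWithinAt (fun y => uxxx y t) (uxxxx x t) (Set.Icc 0 1) x) ∧
  (∀ x ∈ Set.Icc (0:ℝ) 1, ∀ t ∈ Set.Icc (0:ℝ) T,
      HasDerivWithinAt (fun s => u x s) (ut x t) (Set.Icc 0 T) t) ∧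
  ContinuousOn (fun q : ℝ × ℝ => u q.1 q.2) (Set.Icc 0 1 ×ˢ Set.Icc 0 T) ∧
  ContinuousOn (fun q : ℝ × ℝ => ux q.1 q.2) (Set.Icc 0 1 ×ˢ Set.Icc 0 T) ∧
  ContinuousOn (fun q : ℝ × ℝ => uxx q.1 q.2) (Set.Icc 0 1 ×ˢ Set.Icc 0 T) ∧
  ContinuousOn (fun q : ℝ × ℝ => uxxx q.1 q.2) (Set.Icc 0 1 ×ˢ Set.Icc 0 T) ∧
  ContinuousOn (fun q : ℝ × ℝ => uxxxx q.1 q.2) (Set.Icc 0 1 ×ˢ Set.Icc 0 T) ∧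
  ContinuousOn (fun q : ℝ × ℝ => ut q.1 q.2) (Set.Icc 0 1 ×ˢ Set.Icc 0 T) ∧
  (∀ x ∈ Set.Ioo (0:ℝ) 1, ∀ t ∈ Set.Ioo (0:ℝ) T,
      Complex.I * ut x t + Complex.I * (χ : ℂ) * (Bcoef α β t : ℂ) * uxxx x t
        + (γ : ℂ) * (Ccoef α β t : ℂ) * uxx x t + Icoef α β x t * ux x t
        + Complex.I * (ε : ℂ) * (Bcoef α β t : ℂ) * uxxxx x t
        - (‖u x t‖ : ℂ) ^ 2 * u x t = 0) ∧
  (∀ t ∈ Set.Icc (0:ℝ) T,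
      u 0 t = 0 ∧ u 1 t = 0 ∧ ux 0 t = 0 ∧ ux 1 t = 0 ∧
      uxx 0 t = 0 ∧ uxx 1 t = 0 ∧ uxxx 0 t = 0 ∧ uxxx 1 t = 0)

/-- the basic weighted energy identity for a classical solution of the
ε-regularized problem (0 ≤ ε, 3χ − 4ε > 0):  for every t ∈ (0,T),
(d/dt)⟨eˣ,|u|²⟩ − (χ−ε)𝔅(t)⟨eˣ,|u|²⟩ + (3χ−4ε)𝔅(t)⟨eˣ,|uₓ|²⟩ + 2ε𝔅(t)⟨eˣ,|uₓₓ|²⟩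
  = 2γℭ(t)·Im ∫₀¹ eˣ·conj(u)·uₓ dx − 2·Im ∫₀¹ I(x,t)·eˣ·conj(u)·uₓ dx. -/
theorem stmt2 (T α₀ β₀ γ χ ε : ℝ) (α β : ℝ → ℝ)
    (hmb : MovingBoundary T α₀ β₀ α β) (hγ : 0 < γ) (hχ : 0 < χ)
    (hε : 0 ≤ ε) (hε' : 3 * χ - 4 * ε > 0)
    (u ux uxx uxxx uxxxx ut : ℝ → ℝ → ℂ)
    (hu : IsRegSol T γ χ ε α β u ux uxx uxxx uxxxx ut) :
    ∀ t ∈ Set.Ioo (0:ℝ) T,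
      HasDerivAt (fun s => ∫ x in (0:ℝ)..1, Real.exp x * ‖u x s‖ ^ 2)
        ((χ - ε) * Bcoef α β t * (∫ x in (0:ℝ)..1, Real.exp x * ‖u x t‖ ^ 2)
          - (3 * χ - 4 * ε) * Bcoef α β t * (∫ x in (0:ℝ)..1, Real.exp x * ‖ux x t‖ ^ 2)
          - 2 * ε * Bcoef α β t * (∫ x in (0:ℝ)..1, Real.exp x * ‖uxx x t‖ ^ 2)
          + 2 * γ * Ccoef α β t
              * (∫ x in (0:ℝ)..1, (Real.exp x : ℂ) * (starRingEnd ℂ (u x t) * ux x t)).im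
          - 2 * (∫ x in (0:ℝ)..1,
              Icoef α β x t * (Real.exp x : ℂ) * (starRingEnd ℂ (u x t) * ux x t)).im) t := by
  intro t ht
  have htI := Set.Ioo_subset_Icc_self ht
  obtain ⟨h₁, h₂, h₃, h₄, hd, cu, -, -, -, -, cut, hpde, hbc⟩ := hu
  obtain ⟨u0, u1, ux0, ux1, -, -, -, -⟩ := hbc t htI
  have key := integral_exp_mul_energy_density (γ * Ccoef α β t) (χ * Bcoef α β t)
    (ε * Bcoef α β t)
    (fun x => -(deriv α t) * pcoef α β t + x * deriv (fun s => Real.log (pcoef α β s)) t)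
    (fun x => u x t) (fun x => ux x t) (fun x => uxx x t) (fun x => uxxx x t)
    (fun x => uxxxx x t) (fun x => ut x t) (by fun_prop)
    (h₁ t htI) (h₂ t htI) (h₃ t htI) (h₄ t htI)
    (cut.comp (f := fun x : ℝ => (x, t)) (by fun_prop) (fun x hx => ⟨hx, htI⟩))
    (fun x hx => by
      have h := hpde x hx t ht
      simp only [Icoef] at h
      push_cast at h ⊢
      linear_combination h)
    u0 u1 ux0 ux1
  have cre := Complex.continuous_re.comp_continuousOn cu
  have cim := Complex.continuous_im.comp_continuousOn cu
  have cret := Complex.continuous_re.comp_continuousOn cut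
  have cimt := Complex.continuous_im.comp_continuousOn cut
  have hderiv := hasDerivAt_integral_of_continuousOn_rect ht
    (f := fun x s => Real.exp x * ‖u x s‖ ^ 2)
    (f' := fun x s => Real.exp x *
      (2 * ((u x s).re * (ut x s).re + (u x s).im * (ut x s).im)))
    (by fun_prop)
    ((Real.continuous_exp.comp_continuousOn continuousOn_fst).mul
      (continuousOn_const.mul ((cre.mul cret).add (cim.mul cimt))))
    (fun x hx s hs => by
      have h := (hd x hx s (Set.Ioo_subset_Icc_self hs)).hasDerivAt
        (Icc_mem_nhds hs.1 hs.2)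
      have a := Complex.reCLM.hasFDerivAt.comp_hasDerivAt s h
      have b := Complex.imCLM.hasFDerivAt.comp_hasDerivAt s h
      have hab := ((a.mul a).add (b.mul b)).const_mul (Real.exp x)
      simp only [← Complex.normSq_eq_norm_sq, Complex.normSq_apply]
      refine hab.congr_deriv ?_
      simp
      ring)
  refine hderiv.congr_deriv (key.trans ?_)
  simp only [Icoef]
  ring
end

section
/- Let u and w be two classical solutions of the transformed problem with the same initial datum, i.e. u(x,0) = w(x,0) for all x ∈ [0,1]. Then u = w on [0,1] × [0,T]. -/
/- A classical solution of the transformed problem: u, uₓ, uₓₓ, uₓₓₓ, u_t are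
   continuous on [0,1] × [0,T] (ux, uxx, uxxx the successive x-derivatives and ut the
   t-derivative of u), u satisfies
   i·u_t + i·χ·𝔅(t)·u_xxx + γ·ℭ(t)·u_xx + I(x,t)·u_x − |u|²·u = 0 on (0,1) × (0,T),
   and u = u_x = u_xx = u_xxx = 0 at x = 0 and x = 1 for all t ∈ [0,T]. -/
def IsTransfSol (T γ χ : ℝ) (α β : ℝ → ℝ)
    (u ux uxx uxxx ut : ℝ → ℝ → ℂ) : Prop :=
  (∀ t ∈ Set.Icc (0:ℝ) T, ∀ x ∈ Set.Icc (0:ℝ) 1,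
      HasDerivWithinAt (fun y => u y t) (ux x t) (Set.Icc 0 1) x) ∧
  (∀ t ∈ Set.Icc (0:ℝ) T, ∀ x ∈ Set.Icc (0:ℝ) 1,
      HasDerivWithinAt (fun y => ux y t) (uxx x t) (Set.Icc 0 1) x) ∧
  (∀ t ∈ Set.Icc (0:ℝ) T, ∀ x ∈ Set.Icc (0:ℝ) 1,
      HasDerivWithinAt (fun y => uxx y t) (uxxx x t) (Set.Icc 0 1) x) ∧
  (∀ x ∈ Set.Icc (0:ℝ) 1, ∀ t ∈ Set.Icc (0:ℝ) T,
      HasDerivWithinAt (fun s => u x s) (ut x t) (Set.Icc 0 T) t) ∧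
  ContinuousOn (fun q : ℝ × ℝ => u q.1 q.2) (Set.Icc 0 1 ×ˢ Set.Icc 0 T) ∧
  ContinuousOn (fun q : ℝ × ℝ => ux q.1 q.2) (Set.Icc 0 1 ×ˢ Set.Icc 0 T) ∧
  ContinuousOn (fun q : ℝ × ℝ => uxx q.1 q.2) (Set.Icc 0 1 ×ˢ Set.Icc 0 T) ∧
  ContinuousOn (fun q : ℝ × ℝ => uxxx q.1 q.2) (Set.Icc 0 1 ×ˢ Set.Icc 0 T) ∧
  ContinuousOn (fun q : ℝ × ℝ => ut q.1 q.2) (Set.Icc 0 1 ×ˢ Set.Icc 0 T) ∧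
  (∀ x ∈ Set.Ioo (0:ℝ) 1, ∀ t ∈ Set.Ioo (0:ℝ) T,
      Complex.I * ut x t + Complex.I * (χ : ℂ) * (Bcoef α β t : ℂ) * uxxx x t
        + (γ : ℂ) * (Ccoef α β t : ℂ) * uxx x t + Icoef α β x t * ux x t
        - (‖u x t‖ : ℂ) ^ 2 * u x t = 0) ∧
  (∀ t ∈ Set.Icc (0:ℝ) T,
      u 0 t = 0 ∧ u 1 t = 0 ∧ ux 0 t = 0 ∧ ux 1 t = 0 ∧
      uxx 0 t = 0 ∧ uxx 1 t = 0 ∧ uxxx 0 t = 0 ∧ uxxx 1 t = 0)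

open Set MeasureTheory
open scoped Interval

/-- Restricting to a horizontal slice preserves continuity on a rectangle. -/
lemma ContinuousOn.slice_left {E : Type*} [TopologicalSpace E] {f : ℝ × ℝ → E} {s r : Set ℝ}
    (hf : ContinuousOn f (s ×ˢ r)) {t : ℝ} (ht : t ∈ r) :
    ContinuousOn (fun x => f (x, t)) s :=
  hf.comp (by fun_prop) fun _ hx => ⟨hx, ht⟩

lemma continuousOn_integral_slice {T : ℝ} (hT : 0 ≤ T) {f : ℝ × ℝ → ℝ}
    (hf : ContinuousOn f (Icc 0 1 ×ˢ Icc 0 T)) :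
    ContinuousOn (fun t => ∫ x in (0:ℝ)..1, f (x, t)) (Icc 0 T) := by
  have hcont : Continuous (Function.uncurry fun t x : ℝ =>
      f (projIcc 0 1 zero_le_one x, projIcc 0 T hT t)) := by
    refine hf.comp_continuous (f := fun q : ℝ × ℝ =>
      ((projIcc 0 1 zero_le_one q.2 : ℝ), (projIcc 0 T hT q.1 : ℝ))) ?_ ?_
    · exact (continuous_subtype_val.comp (continuous_projIcc.comp continuous_snd)).prodMk
        (continuous_subtype_val.comp (continuous_projIcc.comp continuous_fst))
    · exact fun q => ⟨Subtype.coe_prop _, Subtype.coe_prop _⟩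
  refine (intervalIntegral.continuous_parametric_intervalIntegral_of_continuous'
    (μ := volume) hcont 0 1).continuousOn.congr fun t ht => ?_
  refine intervalIntegral.integral_congr fun x hx => ?_
  rw [uIcc_of_le zero_le_one] at hx
  simp only [projIcc_of_mem _ hx, projIcc_of_mem _ ht]

lemma hasDerivAt_integral_slice {T : ℝ} {f f' : ℝ × ℝ → ℝ}
    (hf : ContinuousOn f (Icc 0 1 ×ˢ Icc 0 T)) (hf' : ContinuousOn f' (Icc 0 1 ×ˢ Icc 0 T))
    (hd : ∀ x ∈ Icc (0:ℝ) 1, ∀ t ∈ Ioo (0:ℝ) T, HasDerivAt (fun s => f (x, s)) (f' (x, t)) t)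
    {t : ℝ} (ht : t ∈ Ioo 0 T) :
    HasDerivAt (fun s => ∫ x in (0:ℝ)..1, f (x, s)) (∫ x in (0:ℝ)..1, f' (x, t)) t := by
  obtain ⟨C, hC⟩ := (isCompact_Icc.prod isCompact_Icc).exists_bound_of_continuousOn hf'
  have hsub : Ι (0:ℝ) 1 ⊆ Icc 0 1 := by
    rw [uIoc_of_le zero_le_one]
    exact Ioc_subset_Icc_self
  have hmeas : ∀ g : ℝ × ℝ → ℝ, ContinuousOn g (Icc 0 1 ×ˢ Icc 0 T) → ∀ s ∈ Ioo 0 T,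
      AEStronglyMeasurable (fun x => g (x, s)) (volume.restrict (Ι (0:ℝ) 1)) := fun g hg s hs =>
    ((hg.slice_left (Ioo_subset_Icc_self hs)).mono hsub).aestronglyMeasurable
      measurableSet_uIoc
  refine (intervalIntegral.hasDerivAt_integral_of_dominated_loc_of_deriv_le
    (F := fun s x => f (x, s)) (F' := fun s x => f' (x, s)) (bound := fun _ => C)
    (Ioo_mem_nhds ht.1 ht.2) ?_ ?_ (hmeas f' hf' t ht) ?_ intervalIntegrable_const ?_).2
  · filter_upwards [Ioo_mem_nhds ht.1 ht.2] with s hs using hmeas f hf s hs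
  · exact (hf.slice_left (Ioo_subset_Icc_self ht)).intervalIntegrable_of_Icc zero_le_one
  · exact Filter.Eventually.of_forall fun x hx s hs =>
      hC (x, s) ⟨hsub hx, Ioo_subset_Icc_self hs⟩
  · exact Filter.Eventually.of_forall fun x hx s hs => hd x (hsub hx) s hs

/-- A nonnegative density with zero initial value whose integral satisfies a linear
differential inequality vanishes identically. -/
lemma eq_zero_of_integral_deriv_le {T K : ℝ} (hT : 0 ≤ T) {f f' : ℝ × ℝ → ℝ}
    (hf : ContinuousOn f (Icc 0 1 ×ˢ Icc 0 T)) (hf' : ContinuousOn f' (Icc 0 1 ×ˢ Icc 0 T))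
    (hd : ∀ x ∈ Icc (0:ℝ) 1, ∀ t ∈ Ioo (0:ℝ) T, HasDerivAt (fun s => f (x, s)) (f' (x, t)) t)
    (hnonneg : ∀ q, 0 ≤ f q) (h0 : ∀ x ∈ Icc (0:ℝ) 1, f (x, 0) = 0)
    (hle : ∀ t ∈ Ioo (0:ℝ) T,
      ∫ x in (0:ℝ)..1, f' (x, t) ≤ K * ∫ x in (0:ℝ)..1, f (x, t)) :
    ∀ x ∈ Icc (0:ℝ) 1, ∀ t ∈ Icc (0:ℝ) T, f (x, t) = 0 := by
  intro x hx t ht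
  have hderiv : ∀ s ∈ Ioo (0:ℝ) T, HasDerivAt
      (fun s => Real.exp (-K * s) * ∫ x in (0:ℝ)..1, f (x, s))
      (Real.exp (-K * s) * (-K) * (∫ x in (0:ℝ)..1, f (x, s))
        + Real.exp (-K * s) * ∫ x in (0:ℝ)..1, f' (x, s)) s := fun s hs => by
    have h1 : HasDerivAt (fun s => Real.exp (-K * s)) (Real.exp (-K * s) * (-K)) s := by
      simpa using ((hasDerivAt_id s).const_mul (-K)).exp
    exact h1.mul (hasDerivAt_integral_slice hf hf' hd hs)
  have hanti : AntitoneOn (fun s => Real.exp (-K * s) * ∫ x in (0:ℝ)..1, f (x, s))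
      (Icc 0 T) := by
    refine antitoneOn_of_deriv_nonpos (convex_Icc 0 T)
      ((by fun_prop : Continuous fun s => Real.exp (-K * s)).continuousOn.mul
        (continuousOn_integral_slice hT hf)) ?_ ?_
    · rw [interior_Icc]
      exact fun s hs => (hderiv s hs).differentiableAt.differentiableWithinAt
    · rw [interior_Icc]
      intro s hs
      rw [(hderiv s hs).deriv]
      have := mul_le_mul_of_nonneg_left (hle s hs) (Real.exp_pos (-K * s)).le
      linarith
  have hinit : ∫ x in (0:ℝ)..1, f (x, 0) = 0 := by
    refine (intervalIntegral.integral_congr (g := fun _ => (0:ℝ)) fun y hy => ?_).trans (by simp)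
    exact h0 y (by rwa [uIcc_of_le zero_le_one] at hy)
  have hE : ∫ x in (0:ℝ)..1, f (x, t) ≤ 0 := by
    have := hanti ⟨le_rfl, hT⟩ ht ht.1
    simp only [hinit, mul_zero] at this
    exact nonpos_of_mul_nonpos_right this (Real.exp_pos _)
  by_contra hne
  exact absurd hE (not_le.2 (intervalIntegral.integral_pos zero_lt_one (hf.slice_left ht)
    (fun y _ => hnonneg _) ⟨x, hx, lt_of_le_of_ne (hnonneg _) (Ne.symm hne)⟩))

/-- Integration by parts for the linear spatial operator: the dispersive terms do not contribute
to the energy balance and the transport term contributes only through its divergence. -/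
lemma integral_spatial_terms {p p₁ p₂ p₃ q q₁ q₂ q₃ : ℝ → ℝ} (b c a l : ℝ)
    (hp : ∀ x ∈ Icc (0:ℝ) 1, HasDerivWithinAt p (p₁ x) (Icc 0 1) x)
    (hp₁ : ∀ x ∈ Icc (0:ℝ) 1, HasDerivWithinAt p₁ (p₂ x) (Icc 0 1) x)
    (hp₂ : ∀ x ∈ Icc (0:ℝ) 1, HasDerivWithinAt p₂ (p₃ x) (Icc 0 1) x)
    (hq : ∀ x ∈ Icc (0:ℝ) 1, HasDerivWithinAt q (q₁ x) (Icc 0 1) x)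
    (hq₁ : ∀ x ∈ Icc (0:ℝ) 1, HasDerivWithinAt q₁ (q₂ x) (Icc 0 1) x)
    (hq₂ : ∀ x ∈ Icc (0:ℝ) 1, HasDerivWithinAt q₂ (q₃ x) (Icc 0 1) x)
    (hp₃ : ContinuousOn p₃ (Icc 0 1)) (hq₃ : ContinuousOn q₃ (Icc 0 1))
    (p0 : p 0 = 0) (p1 : p 1 = 0) (q0 : q 0 = 0) (q1 : q 1 = 0)
    (p₁0 : p₁ 0 = 0) (p₁1 : p₁ 1 = 0) (q₁0 : q₁ 0 = 0) (q₁1 : q₁ 1 = 0) :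
    let g := fun x => 2 * b * (p x * p₃ x + q x * q₃ x) + 2 * c * (p x * q₂ x - q x * p₂ x)
      + 2 * (a + x * l) * (p x * p₁ x + q x * q₁ x) + l * (p x ^ 2 + q x ^ 2)
    IntervalIntegrable g volume 0 1 ∧ ∫ x in (0:ℝ)..1, g x = 0 := by
  intro g
  have cp : ContinuousOn p (Icc 0 1) := fun x hx => (hp x hx).continuousWithinAt
  have cp₁ : ContinuousOn p₁ (Icc 0 1) := fun x hx => (hp₁ x hx).continuousWithinAt
  have cp₂ : ContinuousOn p₂ (Icc 0 1) := fun x hx => (hp₂ x hx).continuousWithinAt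
  have cq : ContinuousOn q (Icc 0 1) := fun x hx => (hq x hx).continuousWithinAt
  have cq₁ : ContinuousOn q₁ (Icc 0 1) := fun x hx => (hq₁ x hx).continuousWithinAt
  have cq₂ : ContinuousOn q₂ (Icc 0 1) := fun x hx => (hq₂ x hx).continuousWithinAt
  have hg : IntervalIntegrable g volume 0 1 := by
    refine ContinuousOn.intervalIntegrable_of_Icc zero_le_one ?_
    fun_prop
  refine ⟨hg, ?_⟩
  rw [intervalIntegral.integral_eq_sub_of_hasDerivAt_of_le (f := fun x =>
      b * (2 * (p x * p₂ x + q x * q₂ x) - (p₁ x ^ 2 + q₁ x ^ 2))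
        + 2 * c * (p x * q₁ x - q x * p₁ x) + (a + x * l) * (p x ^ 2 + q x ^ 2)) zero_le_one ?_ ?_ hg]
  · simp [p0, p1, q0, q1, p₁0, p₁1, q₁0, q₁1]
  · fun_prop
  · intro x hx
    have hI := Ioo_subset_Icc_self hx
    have hN : Icc (0:ℝ) 1 ∈ nhds x := Icc_mem_nhds hx.1 hx.2
    have dp := (hp x hI).hasDerivAt hN
    have dp₁ := (hp₁ x hI).hasDerivAt hN
    have dp₂ := (hp₂ x hI).hasDerivAt hN
    have dq := (hq x hI).hasDerivAt hN
    have dq₁ := (hq₁ x hI).hasDerivAt hN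
    have dq₂ := (hq₂ x hI).hasDerivAt hN
    have := (((((dp.mul dp₂).add (dq.mul dq₂)).const_mul 2).sub
      ((dp₁.pow 2).add (dq₁.pow 2))).const_mul b).add
      (((dp.mul dq₁).sub (dq.mul dp₁)).const_mul (2 * c)) |>.add
      ((((hasDerivAt_id x).mul_const l).const_add a).mul ((dp.pow 2).add (dq.pow 2)))
    refine this.congr_deriv ?_
    simp only [g, Pi.add_apply, Pi.pow_apply, id]
    push_cast
    ring

lemma deriv_log_pcoef {α β : ℝ → ℝ} (hα : Differentiable ℝ α) (hβ : Differentiable ℝ β) {t : ℝ}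
    (h : 0 < β t - α t) :
    deriv (fun s => Real.log (pcoef α β s)) t = -(deriv β t - deriv α t) / (β t - α t) := by
  have h1 : (fun s => Real.log (pcoef α β s)) = fun s => -Real.log (β s - α s) := by
    funext s
    rw [pcoef, Real.log_inv]
  rw [h1, neg_div]
  exact ((((hβ t).hasDerivAt.sub (hα t).hasDerivAt).log h.ne').neg).deriv

lemma MovingBoundary.exists_bound_deriv_log {T α₀ β₀ : ℝ} {α β : ℝ → ℝ}
    (h : MovingBoundary T α₀ β₀ α β) :
    ∃ L, ∀ t ∈ Icc (0:ℝ) T, |deriv (fun s => Real.log (pcoef α β s)) t| ≤ L := by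
  obtain ⟨-, hα₀, hα, hβ, hb⟩ := h
  have hpos : ∀ t ∈ Icc (0:ℝ) T, 0 < β t - α t := fun t ht => hα₀.trans_le (hb t ht).1
  have hα' : Continuous (deriv α) := hα.continuous_deriv (by norm_num)
  have hβ' : Continuous (deriv β) := hβ.continuous_deriv (by norm_num)
  have hc : ContinuousOn (fun t => -(deriv β t - deriv α t) / (β t - α t)) (Icc 0 T) :=
    ((hβ'.sub hα').neg.continuousOn).div (hβ.continuous.sub hα.continuous).continuousOn
      fun t ht => (hpos t ht).ne'
  obtain ⟨L, hL⟩ := isCompact_Icc.exists_bound_of_continuousOn hc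
  refine ⟨L, fun t ht => ?_⟩
  rw [deriv_log_pcoef (hα.differentiable (by norm_num)) (hβ.differentiable (by norm_num))
    (hpos t ht)]
  exact hL t ht

/-- Local Lipschitz bound for the contribution of the cubic nonlinearity to the energy. -/
lemma cubic_energy_le {M a b c d : ℝ} (ha : |a| ≤ M) (hb : |b| ≤ M) (hc : |c| ≤ M)
    (hd : |d| ≤ M) :
    (a - c) * ((a ^ 2 + b ^ 2) * b - (c ^ 2 + d ^ 2) * d)
      - (b - d) * ((a ^ 2 + b ^ 2) * a - (c ^ 2 + d ^ 2) * c)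
      ≤ 4 * M ^ 2 * ((a - c) ^ 2 + (b - d) ^ 2) := by
  have hM : 0 ≤ M := (abs_nonneg a).trans ha
  have key : (a - c) * ((a ^ 2 + b ^ 2) * b - (c ^ 2 + d ^ 2) * d)
      - (b - d) * ((a ^ 2 + b ^ 2) * a - (c ^ 2 + d ^ 2) * c)
      = ((a - c) * (a + c) + (b - d) * (b + d)) * ((a - c) * d - (b - d) * c) := by ring
  have h1 : |(a - c) * (a + c) + (b - d) * (b + d)| ≤ 2 * M * (|a - c| + |b - d|) := by
    calc _ ≤ |a - c| * |a + c| + |b - d| * |b + d| := by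
          simpa only [abs_mul] using abs_add_le ((a - c) * (a + c)) ((b - d) * (b + d))
      _ ≤ |a - c| * (M + M) + |b - d| * (M + M) := by
          gcongr
          · exact (abs_add_le a c).trans (add_le_add ha hc)
          · exact (abs_add_le b d).trans (add_le_add hb hd)
      _ = _ := by ring
  have h2 : |(a - c) * d - (b - d) * c| ≤ M * (|a - c| + |b - d|) := by
    calc _ ≤ |a - c| * |d| + |b - d| * |c| := by
          simpa only [abs_mul] using abs_sub ((a - c) * d) ((b - d) * c)
      _ ≤ |a - c| * M + |b - d| * M := by gcongr
      _ = _ := by ring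
  rw [key]
  calc _ ≤ |(a - c) * (a + c) + (b - d) * (b + d)| * |(a - c) * d - (b - d) * c| := by
        rw [← abs_mul]
        exact le_abs_self _
    _ ≤ (2 * M * (|a - c| + |b - d|)) * (M * (|a - c| + |b - d|)) := by gcongr
    _ = 2 * M ^ 2 * (|a - c| + |b - d|) ^ 2 := by ring
    _ ≤ 2 * M ^ 2 * (2 * (|a - c| ^ 2 + |b - d| ^ 2)) := by
        gcongr
        exact add_sq_le
    _ = _ := by
        rw [sq_abs, sq_abs]
        ring

lemma HasDerivWithinAt.complex_re {f : ℝ → ℂ} {f' : ℂ} {s : Set ℝ} {x : ℝ}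
    (h : HasDerivWithinAt f f' s x) : HasDerivWithinAt (fun y => (f y).re) f'.re s x :=
  Complex.reCLM.hasFDerivAt.comp_hasDerivWithinAt x h

lemma HasDerivWithinAt.complex_im {f : ℝ → ℂ} {f' : ℂ} {s : Set ℝ} {x : ℝ}
    (h : HasDerivWithinAt f f' s x) : HasDerivWithinAt (fun y => (f y).im) f'.im s x :=
  Complex.imCLM.hasFDerivAt.comp_hasDerivWithinAt x h

/-- The imaginary part of the difference of two equations tested with the conjugate of the
difference of the solutions. -/
lemma energy_identity {χ B γ C A : ℝ} {u u₁ u₂ u₃ u' w w₁ w₂ w₃ w' : ℂ}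
    (hu : Complex.I * u' + Complex.I * χ * B * u₃ + γ * C * u₂ + Complex.I * (A : ℂ) * u₁
      - (‖u‖ : ℂ) ^ 2 * u = 0)
    (hw : Complex.I * w' + Complex.I * χ * B * w₃ + γ * C * w₂ + Complex.I * (A : ℂ) * w₁
      - (‖w‖ : ℂ) ^ 2 * w = 0) :
    (u - w).re * (u' - w').re + (u - w).im * (u' - w').im
      = -(χ * B * ((u - w).re * (u₃ - w₃).re + (u - w).im * (u₃ - w₃).im)
          + γ * C * ((u - w).re * (u₂ - w₂).im - (u - w).im * (u₂ - w₂).re)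
          + A * ((u - w).re * (u₁ - w₁).re + (u - w).im * (u₁ - w₁).im))
        + ((u.re - w.re) * ((u.re ^ 2 + u.im ^ 2) * u.im - (w.re ^ 2 + w.im ^ 2) * w.im)
          - (u.im - w.im) * ((u.re ^ 2 + u.im ^ 2) * u.re - (w.re ^ 2 + w.im ^ 2) * w.re)) := by
  have hn : ∀ z : ℂ, (‖z‖ : ℂ) ^ 2 = ((z.re ^ 2 + z.im ^ 2 : ℝ) : ℂ) := fun z => by
    rw [← Complex.ofReal_pow, Complex.sq_norm, Complex.normSq_apply]
    congr 1
    ring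
  rw [hn] at hu hw
  have hur := congrArg Complex.re hu
  have hui := congrArg Complex.im hu
  have hwr := congrArg Complex.re hw
  have hwi := congrArg Complex.im hw
  simp only [Complex.add_re, Complex.sub_re, Complex.mul_re, Complex.I_re, Complex.I_im,
    Complex.ofReal_re, Complex.ofReal_im, Complex.add_im, Complex.sub_im, Complex.mul_im,
    Complex.zero_re, Complex.zero_im] at hur hui hwr hwi ⊢
  linear_combination (u.re - w.re) * (hui - hwi) - (u.im - w.im) * (hur - hwr)

/-- uniqueness.  Two classical solutions of the transformed problem with the
same initial datum coincide on [0,1] × [0,T]. -/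
theorem stmt8 (T α₀ β₀ γ χ : ℝ) (α β : ℝ → ℝ)
    (hmb : MovingBoundary T α₀ β₀ α β) (hγ : 0 < γ) (hχ : 0 < χ)
    (u ux uxx uxxx ut : ℝ → ℝ → ℂ) (w wx wxx wxxx wt : ℝ → ℝ → ℂ)
    (hu : IsTransfSol T γ χ α β u ux uxx uxxx ut)
    (hw : IsTransfSol T γ χ α β w wx wxx wxxx wt)
    (h0 : ∀ x ∈ Set.Icc (0:ℝ) 1, u x 0 = w x 0) :
    ∀ x ∈ Set.Icc (0:ℝ) 1, ∀ t ∈ Set.Icc (0:ℝ) T, u x t = w x t := by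
  obtain ⟨L, hL⟩ := hmb.exists_bound_deriv_log
  have hT : 0 ≤ T := hmb.1.le
  obtain ⟨ux', uxx', uxxx', ut', uc, -, -, uxxxc, utc, upde, ubc⟩ := hu
  obtain ⟨wx', wxx', wxxx', wt', wc, -, -, wxxxc, wtc, wpde, wbc⟩ := hw
  obtain ⟨M₁, hM₁⟩ := (isCompact_Icc.prod isCompact_Icc).exists_bound_of_continuousOn uc
  obtain ⟨M₂, hM₂⟩ := (isCompact_Icc.prod isCompact_Icc).exists_bound_of_continuousOn wc
  have cre : ∀ {g h : ℝ → ℝ → ℂ} {s : Set (ℝ × ℝ)}, ContinuousOn (fun q : ℝ × ℝ => g q.1 q.2) s →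
      ContinuousOn (fun q : ℝ × ℝ => h q.1 q.2) s →
      ContinuousOn (fun q : ℝ × ℝ => (g q.1 q.2 - h q.1 q.2).re) s :=
    fun hg hh => Complex.continuous_re.comp_continuousOn (hg.sub hh)
  have cim : ∀ {g h : ℝ → ℝ → ℂ} {s : Set (ℝ × ℝ)}, ContinuousOn (fun q : ℝ × ℝ => g q.1 q.2) s →
      ContinuousOn (fun q : ℝ × ℝ => h q.1 q.2) s →
      ContinuousOn (fun q : ℝ × ℝ => (g q.1 q.2 - h q.1 q.2).im) s :=
    fun hg hh => Complex.continuous_im.comp_continuousOn (hg.sub hh)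
  have hf : ContinuousOn (fun q : ℝ × ℝ =>
      (u q.1 q.2 - w q.1 q.2).re ^ 2 + (u q.1 q.2 - w q.1 q.2).im ^ 2)
      (Set.Icc 0 1 ×ˢ Set.Icc 0 T) := ((cre uc wc).pow 2).add ((cim uc wc).pow 2)
  have hf' : ContinuousOn (fun q : ℝ × ℝ =>
      2 * ((u q.1 q.2 - w q.1 q.2).re * (ut q.1 q.2 - wt q.1 q.2).re
        + (u q.1 q.2 - w q.1 q.2).im * (ut q.1 q.2 - wt q.1 q.2).im))
      (Set.Icc 0 1 ×ˢ Set.Icc 0 T) :=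
    continuousOn_const.mul (((cre uc wc).mul (cre utc wtc)).add ((cim uc wc).mul (cim utc wtc)))
  have hzero := eq_zero_of_integral_deriv_le (K := L + 8 * (max M₁ M₂) ^ 2) hT hf hf' ?_
    (fun q => by positivity) (fun x hx => by simp [h0 x hx]) ?_
  · intro x hx t ht
    have := hzero x hx t ht
    simp only at this
    rw [← sub_eq_zero]
    apply Complex.ext
    · exact pow_eq_zero_iff two_ne_zero |>.1 (by nlinarith)
    · exact pow_eq_zero_iff two_ne_zero |>.1 (by nlinarith)
  · intro x hx t ht
    have hN : Icc (0:ℝ) T ∈ nhds t := Icc_mem_nhds ht.1 ht.2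
    have hd := (ut' x hx t (Ioo_subset_Icc_self ht)).sub (wt' x hx t (Ioo_subset_Icc_self ht))
    refine ((hd.complex_re.hasDerivAt hN).pow 2 |>.add
      ((hd.complex_im.hasDerivAt hN).pow 2)).congr_deriv ?_
    simp only [Pi.sub_apply]
    push_cast
    ring
  · intro t ht
    have htI := Ioo_subset_Icc_self ht
    obtain ⟨u0, u1, ux0, ux1, -⟩ := ubc t htI
    obtain ⟨w0, w1, wx0, wx1, -⟩ := wbc t htI
    set l := deriv (fun s => Real.log (pcoef α β s)) t with hl
    have d0 := fun x hx => (ux' t htI x hx).sub (wx' t htI x hx)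
    have d1 := fun x hx => (uxx' t htI x hx).sub (wxx' t htI x hx)
    have d2 := fun x hx => (uxxx' t htI x hx).sub (wxxx' t htI x hx)
    obtain ⟨hgint, hibp⟩ := integral_spatial_terms (χ * Bcoef α β t) (γ * Ccoef α β t)
      (-(deriv α t) * pcoef α β t) l
      (fun x hx => (d0 x hx).complex_re) (fun x hx => (d1 x hx).complex_re)
      (fun x hx => (d2 x hx).complex_re) (fun x hx => (d0 x hx).complex_im)
      (fun x hx => (d1 x hx).complex_im) (fun x hx => (d2 x hx).complex_im)
      ((cre uxxxc wxxxc).slice_left htI) ((cim uxxxc wxxxc).slice_left htI)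
      (by simp [u0, w0]) (by simp [u1, w1]) (by simp [u0, w0]) (by simp [u1, w1])
      (by simp [ux0, wx0]) (by simp [ux1, wx1]) (by simp [ux0, wx0]) (by simp [ux1, wx1])
    simp only [Pi.sub_apply] at hgint hibp
    have hcont := hf'.slice_left htI
    refine (le_add_of_nonneg_right hibp.ge).trans ?_
    have hint : IntervalIntegrable _ volume 0 1 := hcont.intervalIntegrable_of_Icc zero_le_one
    rw [← intervalIntegral.integral_const_mul, ← intervalIntegral.integral_add hint hgint]
    refine intervalIntegral.integral_mono_on_of_le_Ioo zero_le_one (hint.add hgint)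
      (((hf.slice_left htI).intervalIntegrable_of_Icc zero_le_one).const_mul _) fun x hx => ?_
    have hxI := Ioo_subset_Icc_self hx
    have hid := energy_identity (upde x hx t ht) (wpde x hx t ht)
    have hu' := (hM₁ (x, t) ⟨hxI, htI⟩).trans (le_max_left M₁ M₂)
    have hw' := (hM₂ (x, t) ⟨hxI, htI⟩).trans (le_max_right M₁ M₂)
    have hcub := cubic_energy_le ((Complex.abs_re_le_norm _).trans hu')
      ((Complex.abs_im_le_norm _).trans hu') ((Complex.abs_re_le_norm _).trans hw')
      ((Complex.abs_im_le_norm _).trans hw')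
    have hll := mul_le_mul_of_nonneg_right ((le_abs_self l).trans (hL t htI))
      (by positivity : 0 ≤ (u x t - w x t).re ^ 2 + (u x t - w x t).im ^ 2)
    simp only [Complex.sub_re, Complex.sub_im] at hid hcub hll ⊢
    rw [← hl] at hid
    rw [hid]
    nlinarith
end

section
/- Let u and w be two classical solutions of the transformed problem. Then for every t ∈ (0,T): (d/dt) ∫₀¹ e^x·|u − w|² dx − χ·𝔅(t)·∫₀¹ e^x·|u − w|² dx + 3χ·𝔅(t)·∫₀¹ e^x·|(u − w)_x|² dx = 2γ·ℭ(t)·Im ∫₀¹ e^x·conj(u − w)·(u − w)_x dx − 2·Im ∫₀¹ e^x·I(x,t)·conj(u − w)·(u − w)_x dx + 2·Im ∫₀¹ e^x·conj(u − w)·(|u| + |w|)·(|u| − |w|)·w dx. -/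
open Set MeasureTheory in
/-- Interval integrability on `[0,1]` of the exponentially weighted pairing. -/
theorem intervalIntegrable_exp_mul {f : ℝ → ℂ} (hf : ContinuousOn f (Icc 0 1)) :
    IntervalIntegrable (fun x => (Real.exp x : ℂ) * f x) volume 0 1 := by
  refine ContinuousOn.intervalIntegrable_of_Icc zero_le_one ?_
  exact (Complex.continuous_ofReal.comp Real.continuous_exp).continuousOn.mul hf

theorem continuousOn_conj_mul {a b : ℝ → ℂ} {s : Set ℝ} (ha : ContinuousOn a s)
    (hb : ContinuousOn b s) : ContinuousOn (fun x => starRingEnd ℂ (a x) * b x) s :=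
  (Complex.continuous_conj.comp_continuousOn ha).mul hb

/-- The sesquilinear form `∫₀¹ eˣ conj(a) b dx`. -/
noncomputable def expForm (a b : ℝ → ℂ) : ℂ :=
  ∫ x in (0:ℝ)..1, (Real.exp x : ℂ) * (starRingEnd ℂ (a x) * b x)

theorem conj_expForm (a b : ℝ → ℂ) : starRingEnd ℂ (expForm a b) = expForm b a := by
  unfold expForm
  rw [← intervalIntegral.intervalIntegral_conj]
  congr 1
  ext x
  simp only [map_mul, Complex.conj_ofReal, Complex.conj_conj]
  ring

theorem expForm_self (a : ℝ → ℂ) :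
    expForm a a = ((∫ x in (0:ℝ)..1, Real.exp x * ‖a x‖ ^ 2 : ℝ) : ℂ) := by
  unfold expForm
  rw [← intervalIntegral.integral_ofReal]
  congr 1
  ext x
  rw [Complex.conj_mul']
  push_cast
  rfl

open Set in
/-- Integration by parts for `expForm` with vanishing boundary terms. -/
theorem expForm_deriv_right {a a' b b' : ℝ → ℂ}
    (ha : ∀ x ∈ Icc (0:ℝ) 1, HasDerivWithinAt a (a' x) (Icc 0 1) x)
    (hb : ∀ x ∈ Icc (0:ℝ) 1, HasDerivWithinAt b (b' x) (Icc 0 1) x)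
    (ha' : ContinuousOn a' (Icc 0 1)) (hb' : ContinuousOn b' (Icc 0 1))
    (h0 : a 0 = 0) (h1 : a 1 = 0) :
    expForm a b' = -expForm a' b - expForm a b := by
  have hac : ContinuousOn a (Icc 0 1) := fun x hx => (ha x hx).continuousWithinAt
  have hbc : ContinuousOn b (Icc 0 1) := fun x hx => (hb x hx).continuousWithinAt
  have i1 := intervalIntegrable_exp_mul (continuousOn_conj_mul hac hb')
  have i2 := intervalIntegrable_exp_mul (continuousOn_conj_mul ha' hbc)
  have i3 := intervalIntegrable_exp_mul (continuousOn_conj_mul hac hbc)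
  have key := intervalIntegral.integral_eq_sub_of_hasDerivAt_of_le (zero_le_one' ℝ)
    (f := fun x => (Real.exp x : ℂ) * (starRingEnd ℂ (a x) * b x))
    ((Complex.continuous_ofReal.comp Real.continuous_exp).continuousOn.mul
      (continuousOn_conj_mul hac hbc))
    (fun x hx => by
      have hn := Icc_mem_nhds hx.1 hx.2
      have hx' := Ioo_subset_Icc_self hx
      exact (Real.hasDerivAt_exp x).ofReal_comp.mul
        (((ha x hx').hasDerivAt hn).star.mul ((hb x hx').hasDerivAt hn)))
    (((i1.add i2).add i3).congr (fun x _ => by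
      simp only [← starRingEnd_apply]; ring))
  have hsum : expForm a b' + expForm a' b + expForm a b = 0 := by
    simp only [h0, h1, map_zero, zero_mul, mul_zero, sub_zero] at key
    unfold expForm
    rw [← key, ← intervalIntegral.integral_add i1 i2,
      ← intervalIntegral.integral_add (i1.add i2) i3]
    congr 1
    ext x
    simp only [← starRingEnd_apply]
    ring
  linear_combination hsum

section Dissipation

open Set

variable {v v₁ v₂ v₃ : ℝ → ℂ}

/-- The second-order term of the weighted energy balance. -/
theorem im_expForm_deriv_two
    (h₁ : ∀ x ∈ Icc (0:ℝ) 1, HasDerivWithinAt v (v₁ x) (Icc 0 1) x)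
    (h₂ : ∀ x ∈ Icc (0:ℝ) 1, HasDerivWithinAt v₁ (v₂ x) (Icc 0 1) x)
    (hc₂ : ContinuousOn v₂ (Icc 0 1)) (v0 : v 0 = 0) (v1 : v 1 = 0) :
    (expForm v v₂).im = -(expForm v v₁).im := by
  have hc₁ : ContinuousOn v₁ (Icc 0 1) := fun x hx => (h₂ x hx).continuousWithinAt
  rw [expForm_deriv_right h₁ h₂ hc₁ hc₂ v0 v1, expForm_self v₁]
  simp

/-- The third-order term of the weighted energy balance. -/
theorem two_mul_re_expForm_deriv_three
    (h₁ : ∀ x ∈ Icc (0:ℝ) 1, HasDerivWithinAt v (v₁ x) (Icc 0 1) x)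
    (h₂ : ∀ x ∈ Icc (0:ℝ) 1, HasDerivWithinAt v₁ (v₂ x) (Icc 0 1) x)
    (h₃ : ∀ x ∈ Icc (0:ℝ) 1, HasDerivWithinAt v₂ (v₃ x) (Icc 0 1) x)
    (hc₃ : ContinuousOn v₃ (Icc 0 1)) (v0 : v 0 = 0) (v1 : v 1 = 0)
    (v₁0 : v₁ 0 = 0) (v₁1 : v₁ 1 = 0) :
    2 * (expForm v v₃).re = 3 * (∫ x in (0:ℝ)..1, Real.exp x * ‖v₁ x‖ ^ 2)
      - ∫ x in (0:ℝ)..1, Real.exp x * ‖v x‖ ^ 2 := by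
  have hc₁ : ContinuousOn v₁ (Icc 0 1) := fun x hx => (h₂ x hx).continuousWithinAt
  have hc₂ : ContinuousOn v₂ (Icc 0 1) := fun x hx => (h₃ x hx).continuousWithinAt
  have e₃ := congrArg Complex.re (expForm_deriv_right h₁ h₃ hc₁ hc₃ v0 v1)
  have e₂ := congrArg Complex.re (expForm_deriv_right h₁ h₂ hc₁ hc₂ v0 v1)
  have e₁ := congrArg Complex.re (expForm_deriv_right h₁ h₁ hc₁ hc₁ v0 v1)
  have e₁₂ := congrArg Complex.re (expForm_deriv_right h₂ h₂ hc₂ hc₂ v₁0 v₁1)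
  rw [← conj_expForm v v₁] at e₁
  rw [← conj_expForm v₁ v₂] at e₁₂
  rw [expForm_self] at e₁ e₂ e₁₂
  simp only [Complex.sub_re, Complex.neg_re, Complex.conj_re, Complex.ofReal_re] at e₁ e₂ e₃ e₁₂
  linarith

end Dissipation

open Set MeasureTheory in
/-- Differentiation under the integral sign for the weighted energy. -/
theorem hasDerivAt_integral_exp_mul_norm_sq {T : ℝ} {v vt : ℝ → ℝ → ℂ}
    (hd : ∀ x ∈ Icc (0:ℝ) 1, ∀ t ∈ Icc (0:ℝ) T,
      HasDerivWithinAt (fun s => v x s) (vt x t) (Icc 0 T) t)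
    (hv : ContinuousOn (fun q : ℝ × ℝ => v q.1 q.2) (Icc 0 1 ×ˢ Icc 0 T))
    (hvt : ContinuousOn (fun q : ℝ × ℝ => vt q.1 q.2) (Icc 0 1 ×ˢ Icc 0 T))
    {t : ℝ} (ht : t ∈ Ioo 0 T) :
    HasDerivAt (fun s => ∫ x in (0:ℝ)..1, Real.exp x * ‖v x s‖ ^ 2)
      (2 * (expForm (fun x => v x t) (fun x => vt x t)).re) t := by
  have slice : ∀ {g : ℝ × ℝ → ℝ}, ContinuousOn g (Icc 0 1 ×ˢ Icc 0 T) → ∀ s ∈ Icc 0 T,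
      ContinuousOn (fun x => g (x, s)) (Icc 0 1) := fun hg s hs =>
    hg.comp (by fun_prop) (fun x hx => ⟨hx, hs⟩)
  have hG : ContinuousOn (fun q : ℝ × ℝ => Real.exp q.1 * ‖v q.1 q.2‖ ^ 2)
      (Icc 0 1 ×ˢ Icc 0 T) := by fun_prop
  have hG' : ContinuousOn
      (fun q : ℝ × ℝ => Real.exp q.1 * (2 * inner ℝ (v q.1 q.2) (vt q.1 q.2)))
      (Icc 0 1 ×ˢ Icc 0 T) := by fun_prop
  obtain ⟨C, hC⟩ := (isCompact_Icc.prod isCompact_Icc).exists_bound_of_continuousOn hG'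
  have hsub : uIoc (0:ℝ) 1 ⊆ Icc 0 1 := by
    rw [uIoc_of_le zero_le_one]; exact Ioc_subset_Icc_self
  have ht' := Ioo_subset_Icc_self ht
  have meas : ∀ {g : ℝ → ℝ}, ContinuousOn g (Icc 0 1) →
      AEStronglyMeasurable g (volume.restrict (uIoc 0 1)) := fun hg =>
    (hg.mono hsub).aestronglyMeasurable measurableSet_uIoc
  have main := (intervalIntegral.hasDerivAt_integral_of_dominated_loc_of_deriv_le
    (μ := volume) (a := 0) (b := 1) (bound := fun _ => C)
    (F := fun s x => Real.exp x * ‖v x s‖ ^ 2)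
    (F' := fun s x => Real.exp x * (2 * inner ℝ (v x s) (vt x s)))
    (Ioo_mem_nhds ht.1 ht.2)
    (Filter.mem_of_superset (Ioo_mem_nhds ht.1 ht.2)
      fun s hs => meas (slice hG s (Ioo_subset_Icc_self hs)))
    ((slice hG t ht').intervalIntegrable_of_Icc zero_le_one)
    (meas (slice hG' t ht'))
    (Filter.Eventually.of_forall fun x hx s hs => hC (x, s) ⟨hsub hx, Ioo_subset_Icc_self hs⟩)
    intervalIntegrable_const
    (Filter.Eventually.of_forall fun x hx s hs =>
      (((hd x (hsub hx) s (Ioo_subset_Icc_self hs)).hasDerivAt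
        (Icc_mem_nhds hs.1 hs.2)).norm_sq.const_mul _))).2
  refine main.congr_deriv ?_
  have hvs : ContinuousOn (fun x => v x t) (Icc 0 1) :=
    hv.comp (f := fun x => (x, t)) (by fun_prop) (fun x hx => ⟨hx, ht'⟩)
  have hvts : ContinuousOn (fun x => vt x t) (Icc 0 1) :=
    hvt.comp (f := fun x => (x, t)) (by fun_prop) (fun x hx => ⟨hx, ht'⟩)
  have hre := Complex.reCLM.intervalIntegral_comp_comm
    (intervalIntegrable_exp_mul (continuousOn_conj_mul hvs hvts))
  rw [show (expForm (fun x => v x t) (fun x => vt x t)).re = _ from hre.symm,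
    ← intervalIntegral.integral_const_mul]
  congr 1
  ext x
  simp only [Complex.reCLM_apply, Complex.inner, Complex.re_ofReal_mul]
  rw [mul_comm (starRingEnd ℂ (v x t))]
  ring

/-- the weighted energy identity for the difference of two classical
solutions u, w of the transformed problem:  for every t ∈ (0,T),
(d/dt)∫₀¹eˣ|u−w|²dx − χ𝔅(t)∫₀¹eˣ|u−w|²dx + 3χ𝔅(t)∫₀¹eˣ|(u−w)ₓ|²dx
  = 2γℭ(t)·Im∫₀¹eˣ·conj(u−w)·(u−w)ₓ dx − 2·Im∫₀¹eˣ·I(x,t)·conj(u−w)·(u−w)ₓ dx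
    + 2·Im∫₀¹eˣ·conj(u−w)·(|u|+|w|)·(|u|−|w|)·w dx. -/
theorem stmt9 (T α₀ β₀ γ χ : ℝ) (α β : ℝ → ℝ)
    (hmb : MovingBoundary T α₀ β₀ α β) (hγ : 0 < γ) (hχ : 0 < χ)
    (u ux uxx uxxx ut : ℝ → ℝ → ℂ) (w wx wxx wxxx wt : ℝ → ℝ → ℂ)
    (hu : IsTransfSol T γ χ α β u ux uxx uxxx ut)
    (hw : IsTransfSol T γ χ α β w wx wxx wxxx wt) :
    ∀ t ∈ Set.Ioo (0:ℝ) T,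
      HasDerivAt (fun s => ∫ x in (0:ℝ)..1, Real.exp x * ‖u x s - w x s‖ ^ 2)
        (χ * Bcoef α β t * (∫ x in (0:ℝ)..1, Real.exp x * ‖u x t - w x t‖ ^ 2)
          - 3 * χ * Bcoef α β t * (∫ x in (0:ℝ)..1, Real.exp x * ‖ux x t - wx x t‖ ^ 2)
          + 2 * γ * Ccoef α β t * (∫ x in (0:ℝ)..1,
              (Real.exp x : ℂ) * (starRingEnd ℂ (u x t - w x t) * (ux x t - wx x t))).im
          - 2 * (∫ x in (0:ℝ)..1, (Real.exp x : ℂ) * Icoef α β x t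
              * (starRingEnd ℂ (u x t - w x t) * (ux x t - wx x t))).im
          + 2 * (∫ x in (0:ℝ)..1, (Real.exp x : ℂ) * (starRingEnd ℂ (u x t - w x t)
              * ((‖u x t‖ + ‖w x t‖ : ℝ) : ℂ) * ((‖u x t‖ - ‖w x t‖ : ℝ) : ℂ)
              * w x t)).im) t := by
  intro t ht
  obtain ⟨u1, u2, u3, u4, cu, -, -, cu3, cut, equ, bu⟩ := hu
  obtain ⟨w1, w2, w3, w4, cw, -, -, cw3, cwt, eqw, bw⟩ := hw
  have ht' := Set.Ioo_subset_Icc_self ht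
  have slice : ∀ {g : ℝ → ℝ → ℂ},
      ContinuousOn (fun q : ℝ × ℝ => g q.1 q.2) (Set.Icc 0 1 ×ˢ Set.Icc 0 T) →
      ContinuousOn (fun x => g x t) (Set.Icc 0 1) := fun hg =>
    hg.comp (f := fun x => (x, t)) (by fun_prop) (fun x hx => ⟨hx, ht'⟩)
  have main := hasDerivAt_integral_exp_mul_norm_sq (T := T)
    (v := fun x s => u x s - w x s) (vt := fun x s => ut x s - wt x s)
    (fun x hx s hs => (u4 x hx s hs).sub (w4 x hx s hs)) (cu.sub cw) (cut.sub cwt) ht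
  refine main.congr_deriv ?_
  have h₁ := fun x hx => (u1 t ht' x hx).sub (w1 t ht' x hx)
  have h₂ := fun x hx => (u2 t ht' x hx).sub (w2 t ht' x hx)
  have h₃ := fun x hx => (u3 t ht' x hx).sub (w3 t ht' x hx)
  have hc₃ : ContinuousOn (fun x => uxxx x t - wxxx x t) (Set.Icc 0 1) :=
    (slice cu3).sub (slice cw3)
  obtain ⟨bu0, bu1, bu10, bu11, -⟩ := bu t ht'
  obtain ⟨bw0, bw1, bw10, bw11, -⟩ := bw t ht'
  have hcu := slice cu
  have hcw := slice cw
  have hcv : ContinuousOn (fun x => u x t - w x t) (Set.Icc 0 1) := hcu.sub hcw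
  have hc₁ : ContinuousOn (fun x => ux x t - wx x t) (Set.Icc 0 1) :=
    fun x hx => (h₂ x hx).continuousWithinAt
  have hc₂ : ContinuousOn (fun x => uxx x t - wxx x t) (Set.Icc 0 1) :=
    fun x hx => (h₃ x hx).continuousWithinAt
  have d₃ := two_mul_re_expForm_deriv_three (v := fun x => u x t - w x t)
    (v₁ := fun x => ux x t - wx x t) (v₂ := fun x => uxx x t - wxx x t)
    (v₃ := fun x => uxxx x t - wxxx x t) h₁ h₂ h₃ hc₃
    (by simp [bu0, bw0]) (by simp [bu1, bw1]) (by simp [bu10, bw10]) (by simp [bu11, bw11])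
  have d₂ := im_expForm_deriv_two (v := fun x => u x t - w x t)
    (v₁ := fun x => ux x t - wx x t) (v₂ := fun x => uxx x t - wxx x t)
    h₁ h₂ hc₂ (by simp [bu0, bw0]) (by simp [bu1, bw1])
  have hI : Continuous (fun x => Icoef α β x t) := by
    unfold Icoef
    fun_prop
  have i₃ := intervalIntegrable_exp_mul (continuousOn_conj_mul hcv hc₃)
  have i₂ := intervalIntegrable_exp_mul (continuousOn_conj_mul hcv hc₂)
  have iI := intervalIntegrable_exp_mul
    (f := fun x => Icoef α β x t * (starRingEnd ℂ (u x t - w x t) * (ux x t - wx x t)))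
    (hI.continuousOn.mul (continuousOn_conj_mul hcv hc₁))
  have iK := intervalIntegrable_exp_mul
    (f := fun x => starRingEnd ℂ (u x t - w x t) * ((‖u x t‖ + ‖w x t‖ : ℝ) : ℂ)
      * ((‖u x t‖ - ‖w x t‖ : ℝ) : ℂ) * w x t)
    ((((Complex.continuous_conj.comp_continuousOn hcv).mul
    (Complex.continuous_ofReal.comp_continuousOn (hcu.norm.add hcw.norm))).mul
    (Complex.continuous_ofReal.comp_continuousOn (hcu.norm.sub hcw.norm))).mul hcw)
  have iR : IntervalIntegrable
      (fun x => ((Real.exp x * (‖u x t‖ ^ 2 * ‖u x t - w x t‖ ^ 2) : ℝ) : ℂ))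
      MeasureTheory.volume 0 1 := by
    refine ContinuousOn.intervalIntegrable_of_Icc zero_le_one ?_
    fun_prop
  have balance : expForm (fun x => u x t - w x t) (fun x => ut x t - wt x t) =
      -((χ * Bcoef α β t : ℝ) : ℂ) *
          expForm (fun x => u x t - w x t) (fun x => uxxx x t - wxxx x t)
        + Complex.I * ((γ * Ccoef α β t : ℝ) : ℂ) *
          expForm (fun x => u x t - w x t) (fun x => uxx x t - wxx x t)
        + Complex.I * (∫ x in (0:ℝ)..1, (Real.exp x : ℂ) * (Icoef α β x t
              * (starRingEnd ℂ (u x t - w x t) * (ux x t - wx x t))))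
        - Complex.I * ((∫ x in (0:ℝ)..1,
            Real.exp x * (‖u x t‖ ^ 2 * ‖u x t - w x t‖ ^ 2) : ℝ) : ℂ)
        - Complex.I * (∫ x in (0:ℝ)..1, (Real.exp x : ℂ) * (starRingEnd ℂ (u x t - w x t)
              * ((‖u x t‖ + ‖w x t‖ : ℝ) : ℂ) * ((‖u x t‖ - ‖w x t‖ : ℝ) : ℂ)
              * w x t)) := by
    unfold expForm
    rw [← intervalIntegral.integral_ofReal]
    simp only [← intervalIntegral.integral_const_mul]
    rw [← intervalIntegral.integral_add (i₃.const_mul _) (i₂.const_mul _),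
      ← intervalIntegral.integral_add ((i₃.const_mul _).add (i₂.const_mul _)) (iI.const_mul _),
      ← intervalIntegral.integral_sub
        (((i₃.const_mul _).add (i₂.const_mul _)).add (iI.const_mul _)) (iR.const_mul _),
      ← intervalIntegral.integral_sub
        ((((i₃.const_mul _).add (i₂.const_mul _)).add (iI.const_mul _)).sub (iR.const_mul _))
        (iK.const_mul _)]
    refine intervalIntegral.integral_congr_Ioo_of_le zero_le_one fun x hx => ?_
    have eu := equ x hx t ht
    have ew := eqw x hx t ht
    have hn := Complex.conj_mul' (u x t - w x t)
    simp only [Complex.ofReal_mul, Complex.ofReal_add, Complex.ofReal_sub, Complex.ofReal_pow]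
    rw [← hn]
    linear_combination (-Complex.I * Real.exp x * starRingEnd ℂ (u x t - w x t)) * (eu - ew)
      + (Real.exp x * starRingEnd ℂ (u x t - w x t) *
          (ut x t - wt x t + χ * Bcoef α β t * (uxxx x t - wxxx x t))) * Complex.I_mul_I
  have hre := congrArg Complex.re balance
  simp only [Complex.add_re, Complex.sub_re, Complex.mul_re, Complex.mul_im, Complex.neg_re,
    Complex.neg_im, Complex.I_re, Complex.I_im, Complex.ofReal_re, Complex.ofReal_im] at hre
  simp only [mul_assoc] at hre d₂ d₃ ⊢
  rw [hre, d₂]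
  simp only [expForm] at d₃ ⊢
  linear_combination (-(χ * Bcoef α β t)) * d₃
end

section
/- Let Δt > 0, let b, c be real numbers, let χ > 0, γ > 0, and suppose u, w ∈ ℂ^M satisfy the Crank–Nicolson step i·(w − u)/Δt + i·χ·b·D³ m + γ·c·D² m − (|m|² ⊙ m) = 0, where m := (u + w)/2, |m|² ⊙ m denotes the vector with components |m_j|²·m_j, and D², D³ are the finite-difference matrices defined in the context. Then ‖w‖₂ = ‖u‖₂, i.e. the scheme conserves the discrete L²-norm ‖v‖₂² = ∑_j |v_j|². -/
/- The finite-difference matrices on ℝ^M with zero Dirichlet boundary values: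
   D² : centered second difference, −2/Δx² on the diagonal, 1/Δx² on the first
        super- and subdiagonal,
   D³ : pentadiagonal centered third difference,
        (D³u)_j = (u_{j+2} − 2u_{j+1} + 2u_{j−1} − u_{j−2})/(2Δx³). -/
noncomputable def D2mat (M : ℕ) (Δx : ℝ) : Matrix (Fin M) (Fin M) ℝ :=
  Matrix.of fun i j =>
    if i = j then -2 / Δx ^ 2
    else if (j : ℕ) = (i : ℕ) + 1 ∨ (i : ℕ) = (j : ℕ) + 1 then 1 / Δx ^ 2
    else 0

noncomputable def D3mat (M : ℕ) (Δx : ℝ) : Matrix (Fin M) (Fin M) ℝ :=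
  Matrix.of fun i j =>
    if (j : ℕ) = (i : ℕ) + 2 then 1 / (2 * Δx ^ 3)
    else if (j : ℕ) = (i : ℕ) + 1 then -(2 / (2 * Δx ^ 3))
    else if (i : ℕ) = (j : ℕ) + 1 then 2 / (2 * Δx ^ 3)
    else if (i : ℕ) = (j : ℕ) + 2 then -(1 / (2 * Δx ^ 3))
    else 0

theorem D2mat_transpose (M : ℕ) (Δx : ℝ) : (D2mat M Δx).transpose = D2mat M Δx := by
  ext i j
  simp only [D2mat, Matrix.transpose_apply, Matrix.of_apply, eq_comm (a := j) (b := i),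
    or_comm (a := (i : ℕ) = j + 1)]

theorem D3mat_transpose (M : ℕ) (Δx : ℝ) : (D3mat M Δx).transpose = -D3mat M Δx := by
  ext i j
  simp only [D3mat, Matrix.transpose_apply, Matrix.of_apply, Matrix.neg_apply]
  split_ifs <;> first | omega | simp

/-- Conjugating the quadratic form of a real matrix transposes the matrix. -/
theorem conj_sum_conj_mul_mulVec {n : Type*} [Fintype n] (A : Matrix n n ℝ) (v : n → ℂ) :
    starRingEnd ℂ (∑ j, starRingEnd ℂ (v j) * (A.map (fun r => (r : ℂ))).mulVec v j) =
      ∑ j, starRingEnd ℂ (v j) * (A.transpose.map (fun r => (r : ℂ))).mulVec v j := by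
  simp only [Matrix.mulVec, dotProduct, Matrix.map_apply, Matrix.transpose_apply,
    Finset.mul_sum, map_sum, map_mul, Complex.conj_conj, Complex.conj_ofReal]
  rw [Finset.sum_comm]
  refine Finset.sum_congr rfl fun i _ => Finset.sum_congr rfl fun j _ => ?_
  ring

theorem sum_im_conj_mul_mulVec_eq_zero {n : Type*} [Fintype n] {A : Matrix n n ℝ}
    (hA : A.transpose = A) (v : n → ℂ) :
    ∑ j, (starRingEnd ℂ (v j) * (A.map (fun r => (r : ℂ))).mulVec v j).im = 0 := by
  have h := conj_sum_conj_mul_mulVec A v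
  rw [hA] at h
  rw [← Complex.im_sum]
  exact Complex.conj_eq_iff_im.mp h

theorem sum_re_conj_mul_mulVec_eq_zero {n : Type*} [Fintype n] {A : Matrix n n ℝ}
    (hA : A.transpose = -A) (v : n → ℂ) :
    ∑ j, (starRingEnd ℂ (v j) * (A.map (fun r => (r : ℂ))).mulVec v j).re = 0 := by
  have h := congrArg Complex.re (conj_sum_conj_mul_mulVec A v)
  have hneg : (-A).map (fun r => (r : ℂ)) = -A.map (fun r => (r : ℂ)) := by
    ext; simp
  rw [hA, hneg] at h
  simp only [Matrix.neg_mulVec, Pi.neg_apply, mul_neg, Finset.sum_neg_distrib,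
    Complex.conj_re, Complex.neg_re, Complex.re_sum] at h
  linarith

/-- The imaginary part of one component of the Crank–Nicolson equation tested against the
midpoint; `p` and `q` stand for the values of the two difference operators. -/
theorem normSq_sub_normSq_of_midpoint_eq {u w p q : ℂ} {t α β r : ℝ} (ht : t ≠ 0)
    (h : Complex.I * ((w - u) / (t : ℂ)) + Complex.I * (α : ℂ) * p + (β : ℂ) * q
      - (r : ℂ) * ((u + w) / 2) = 0) :
    ‖w‖ ^ 2 - ‖u‖ ^ 2 =
      -(2 * t * α) * (starRingEnd ℂ ((u + w) / 2) * p).re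
        - 2 * t * β * (starRingEnd ℂ ((u + w) / 2) * q).im := by
  have h' : Complex.I * (w - u) + (t : ℂ) * (Complex.I * (α : ℂ) * p + (β : ℂ) * q
      - (r : ℂ) * ((u + w) / 2)) = 0 := by
    have ht' : (t : ℂ) ≠ 0 := Complex.ofReal_ne_zero.mpr ht
    field_simp at h ⊢
    linear_combination h
  have hm : (u + w) / 2 = ⟨(u.re + w.re) / 2, (u.im + w.im) / 2⟩ := by
    apply Complex.ext <;> simp
  rw [hm] at h' ⊢
  have hre := congrArg Complex.re h'
  have him := congrArg Complex.im h'
  simp only [Complex.sq_norm, Complex.normSq_apply]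
  simp at hre him ⊢
  linear_combination (u.re + w.re) * him - (u.im + w.im) * hre

/-- the Crank–Nicolson step conserves the discrete L²-norm.  If u, w ∈ ℂ^M
satisfy i·(w − u)/Δt + i·χ·b·D³m + γ·c·D²m − (|m|² ⊙ m) = 0 with m = (u + w)/2, then
∑_j |w_j|² = ∑_j |u_j|², i.e. ‖w‖₂ = ‖u‖₂. -/
theorem stmt13 (M : ℕ) (hM : 5 ≤ M) (Δx Δt b c χ γ : ℝ)
    (hΔx : 0 < Δx) (hΔt : 0 < Δt) (hχ : 0 < χ) (hγ : 0 < γ)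
    (u w : Fin M → ℂ)
    (hscheme : ∀ j : Fin M,
      Complex.I * ((w j - u j) / (Δt : ℂ))
        + Complex.I * (χ : ℂ) * (b : ℂ)
            * Matrix.mulVec ((D3mat M Δx).map (fun r => (r : ℂ)))
                (fun k => (u k + w k) / 2) j
        + (γ : ℂ) * (c : ℂ)
            * Matrix.mulVec ((D2mat M Δx).map (fun r => (r : ℂ)))
                (fun k => (u k + w k) / 2) j
        - (‖(u j + w j) / 2‖ : ℂ) ^ 2 * ((u j + w j) / 2) = 0) :
    ∑ j, ‖w j‖ ^ 2 = ∑ j, ‖u j‖ ^ 2 := by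
  set m : Fin M → ℂ := fun k => (u k + w k) / 2
  have hj (j : Fin M) := normSq_sub_normSq_of_midpoint_eq (u := u j) (w := w j)
    (p := ((D3mat M Δx).map (fun r => (r : ℂ))).mulVec m j)
    (q := ((D2mat M Δx).map (fun r => (r : ℂ))).mulVec m j)
    (α := χ * b) (β := γ * c) (r := ‖(u j + w j) / 2‖ ^ 2) hΔt.ne'
    (by push_cast; rw [← hscheme j]; ring)
  have h3 := sum_re_conj_mul_mulVec_eq_zero (D3mat_transpose M Δx) m
  have h2 := sum_im_conj_mul_mulVec_eq_zero (D2mat_transpose M Δx) m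
  rw [← sub_eq_zero, ← Finset.sum_sub_distrib, Finset.sum_congr rfl fun j _ => hj j,
    Finset.sum_sub_distrib, ← Finset.mul_sum, ← Finset.mul_sum, h3, h2]
  ring
end
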